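/- arXiv:2604.27484 — 4 statements merged into one kernel-verified Lean document; each statement's English description precedes it below -/
import Mathlib

section
/- Let (S, 𝔪) be a Noetherian local ring with residue field k = S/𝔪, let R be a commutative S-algebra, and let M be an R-module which is flat as an S-module. Then for every natural number ℓ, the length of the R-module (𝔪^ℓ M)/(𝔪^{ℓ+1} M) equals dim_k(𝔪^ℓ/𝔪^{ℓ+1}) times the length of the R-module M/𝔪M, where the equality is of values in ℕ ∪ {∞} (with the convention that a positive natural number times ∞ is ∞, and 0·∞ = 0). -/
open Order IsLocalRing

/-- The length of an `R`-module `M`: the supremum of the lengths of chains of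
submodules of `M`, valued in `ℕ∞`. -/
noncomputable def moduleLength (R M : Type*) [Ring R] [AddCommGroup M]
    [Module R M] : ℕ∞ :=
  Order.height (⊤ : Submodule R M)

open TensorProduct in
theorem aux_ker {S R M N : Type*} [CommRing S] [CommRing R] [Algebra S R] [AddCommGroup M]
    [Module R M] [Module S M] [IsScalarTower S R M] [AddCommGroup N] [Module S N] (I : Ideal S) :
    LinearMap.ker (AlgebraTensorModule.lTensor R M (I • ⊤ : Submodule S N).mkQ) =
      (I.map (algebraMap S R) • ⊤ : Submodule R (M ⊗[S] N)) := by
  apply le_antisymm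
  · intro x hx
    have hex := lTensor_exact M (f := (I • ⊤ : Submodule S N).subtype)
      (g := (I • ⊤ : Submodule S N).mkQ) (LinearMap.exact_subtype_mkQ _)
      (Submodule.mkQ_surjective _)
    obtain ⟨y, rfl⟩ := (hex x).1 hx
    clear hx
    induction y with
    | zero => simp
    | add a b ha hb => rw [map_add]; exact add_mem ha hb
    | tmul m n =>
      obtain ⟨n, hn⟩ := n
      simp only [LinearMap.lTensor_tmul, Submodule.subtype_apply]
      induction hn using Submodule.smul_induction_on' with
      | smul i hi n _ =>
        rw [TensorProduct.tmul_smul, ← algebraMap_smul R i (m ⊗ₜ[S] n)]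
        exact Submodule.smul_mem_smul (Ideal.mem_map_of_mem _ hi) trivial
      | add a _ b _ ha hb => rw [TensorProduct.tmul_add]; exact add_mem ha hb
  · rw [Ideal.map, Submodule.span_smul_eq, Submodule.set_smul_le_iff]
    rintro _ x ⟨i, hi, rfl⟩ -
    rw [LinearMap.mem_ker]
    induction x with
    | zero => simp
    | add a b ha hb => rw [smul_add, map_add, ha, hb, add_zero]
    | tmul m n =>
      rw [algebraMap_smul, ← TensorProduct.tmul_smul]
      have : (I • ⊤ : Submodule S N).mkQ (i • n) = 0 := by
        rw [Submodule.mkQ_apply, Submodule.Quotient.mk_eq_zero]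
        exact Submodule.smul_mem_smul hi trivial
      rw [AlgebraTensorModule.lTensor_tmul, this, TensorProduct.tmul_zero]

open TensorProduct in
theorem aux_equiv {S R M N P : Type*} [CommRing S] [CommRing R] [Algebra S R] [AddCommGroup M]
    [Module R M] [Module S M] [IsScalarTower S R M] [AddCommGroup N] [Module S N]
    [AddCommGroup P] [Module R P] (I : Ideal S) (e : (M ⊗[S] N) ≃ₗ[R] P) :
    Nonempty ((M ⊗[S] (N ⧸ (I • ⊤ : Submodule S N))) ≃ₗ[R]
      (P ⧸ (I.map (algebraMap S R) • ⊤ : Submodule R P))) := by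
  have hs : Function.Surjective (AlgebraTensorModule.lTensor R M (I • ⊤ : Submodule S N).mkQ) :=
    LinearMap.lTensor_surjective M (Submodule.mkQ_surjective _)
  refine ⟨(LinearMap.quotKerEquivOfSurjective _ hs).symm.trans
    (Submodule.Quotient.equiv _ _ e ?_)⟩
  rw [aux_ker]
  have := Submodule.map_smul'' (I.map (algebraMap S R)) (⊤ : Submodule R (M ⊗[S] N)) e.toLinearMap
  rw [Submodule.map_top, LinearEquiv.range] at this
  exact this

open TensorProduct in
theorem aux_flat {S R M : Type*} [CommRing S] [CommRing R] [Algebra S R] [AddCommGroup M]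
    [Module R M] [Module S M] [IsScalarTower S R M] [Module.Flat S M] (J : Ideal S) :
    Nonempty ((M ⊗[S] J) ≃ₗ[R] (J.map (algebraMap S R) • ⊤ : Submodule R M)) := by
  let f : (M ⊗[S] J) →ₗ[R] M := (AlgebraTensorModule.rid S R M).toLinearMap ∘ₗ
    AlgebraTensorModule.lTensor R M (J.subtype)
  have hf : Function.Injective f := (AlgebraTensorModule.rid S R M).injective.comp
    (Module.Flat.lTensor_preserves_injective_linearMap (M := M) J.subtype
      J.injective_subtype)
  have hft (m : M) (j : J) : f (m ⊗ₜ j) = (j : S) • m := by simp [f]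
  have hr : LinearMap.range f = (J.map (algebraMap S R) • ⊤ : Submodule R M) := by
    apply le_antisymm
    · rintro _ ⟨x, rfl⟩
      induction x with
      | zero => simp
      | add a b ha hb => rw [map_add]; exact add_mem ha hb
      | tmul m j =>
        rw [hft, ← algebraMap_smul R (j : S) m]
        exact Submodule.smul_mem_smul (Ideal.mem_map_of_mem _ j.2) trivial
    · rw [Ideal.map, Submodule.span_smul_eq, Submodule.set_smul_le_iff]
      rintro _ x ⟨i, hi, rfl⟩ -
      exact ⟨x ⊗ₜ ⟨i, hi⟩, by rw [hft, algebraMap_smul]⟩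
  exact ⟨(LinearEquiv.ofInjective f hf).trans (LinearEquiv.ofEq _ _ hr)⟩

/-- Let `(S, 𝔪)` be a Noetherian local ring with residue field `k = S/𝔪`, let `R`
be a commutative `S`-algebra, and let `M` be an `R`-module which is flat over `S`.
Then `length_R((𝔪^ℓ M)/(𝔪^(ℓ+1) M)) = dim_k(𝔪^ℓ/𝔪^(ℓ+1)) · length_R(M/𝔪M)`. -/
theorem length_graded_piece_of_flat {S : Type*} [CommRing S] [IsNoetherianRing S]
    [IsLocalRing S] {R : Type*} [CommRing R] [Algebra S R]
    {M : Type*} [AddCommGroup M] [Module R M] [Module S M] [IsScalarTower S R M]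
    [Module.Flat S M] (ℓ : ℕ) :
    moduleLength R
        (↥((maximalIdeal S).map (algebraMap S R) ^ ℓ • ⊤ : Submodule R M) ⧸
          Submodule.comap
            ((maximalIdeal S).map (algebraMap S R) ^ ℓ • ⊤ : Submodule R M).subtype
            ((maximalIdeal S).map (algebraMap S R) ^ (ℓ + 1) • ⊤ : Submodule R M)) =
      (Module.finrank (S ⧸ maximalIdeal S)
          (↥(maximalIdeal S ^ ℓ) ⧸
            (maximalIdeal S • ⊤ : Submodule S ↥(maximalIdeal S ^ ℓ))) : ℕ∞) *
        moduleLength R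
          (M ⧸ ((maximalIdeal S).map (algebraMap S R) • ⊤ : Submodule R M)) := by
  simp only [moduleLength, ← Module.length_eq_height]
  letI : Field (S ⧸ maximalIdeal S) := Ideal.Quotient.field _
  obtain ⟨e⟩ := aux_flat (R := R) (M := M) (maximalIdeal S ^ ℓ)
  rw [Ideal.map_pow] at e
  obtain ⟨e1⟩ := aux_equiv (maximalIdeal S) e
  obtain ⟨e2⟩ := aux_equiv (maximalIdeal S) (TensorProduct.AlgebraTensorModule.rid S R M)
  have hc : Submodule.comap
      ((maximalIdeal S).map (algebraMap S R) ^ ℓ • ⊤ : Submodule R M).subtype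
      ((maximalIdeal S).map (algebraMap S R) ^ (ℓ + 1) • ⊤ : Submodule R M) =
      (maximalIdeal S).map (algebraMap S R) • ⊤ := by
    apply Submodule.map_injective_of_injective (Submodule.injective_subtype _)
    rw [Submodule.map_comap_subtype, Submodule.map_smul'', Submodule.map_top,
      Submodule.range_subtype, pow_succ', ← smul_eq_mul, Submodule.smul_assoc]
    exact inf_eq_right.2 Submodule.smul_le_right
  rw [hc, ← e1.length_eq, ← e2.length_eq]
  have : Module.Finite (S ⧸ maximalIdeal S) (↥(maximalIdeal S ^ ℓ) ⧸
            (maximalIdeal S • ⊤ : Submodule S ↥(maximalIdeal S ^ ℓ))) :=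
    Module.Finite.of_restrictScalars_finite S _ _
  let b := Module.finBasis (S ⧸ maximalIdeal S) (↥(maximalIdeal S ^ ℓ) ⧸
            (maximalIdeal S • ⊤ : Submodule S ↥(maximalIdeal S ^ ℓ)))
  have h0 : (maximalIdeal S • ⊤ : Submodule S S) = maximalIdeal S := by simp
  let c := (b.equivFun.restrictScalars S).trans
    (LinearEquiv.piCongrRight fun _ => (Submodule.quotEquivOfEq _ _ h0).symm)
  rw [((TensorProduct.AlgebraTensorModule.congr (LinearEquiv.refl R M) c).trans
    (TensorProduct.piRight S R M _)).length_eq, Module.length_pi_of_fintype]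
  simp
end

section
/- Let S be a commutative ring with an ideal 𝔪, let R be a commutative S-algebra, and let 𝔱 = 𝔪R be the ideal of R generated by the image of 𝔪. Let m ≥ 1 be a natural number and let b₀ ⊇ b₁ ⊇ ⋯ ⊇ b_m be a decreasing chain of ideals of R such that R/b_p is flat as an S-module for every 0 ≤ p ≤ m. Set 𝔍 = ∑_{j=0}^{m} 𝔱^j · b_{m-j} (the ideal of R generated by all products of 𝔱^j and b_{m-j}). Then for every 0 ≤ ℓ ≤ m−1, one has the equality of ideals 𝔱^ℓ ∩ (𝔱^{ℓ+1} + 𝔍) = 𝔱^ℓ ∩ (𝔱^{ℓ+1} + b_{m-ℓ}). -/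
theorem inf_map_le_aux {S R : Type*} [CommRing S] [CommRing R] [Algebra S R]
    (I : Ideal S) (B : Ideal R) [Module.Flat S (R ⧸ B)] :
    B ⊓ I.map (algebraMap S R) ≤ I.map (algebraMap S R) * B := by
  intro x hx
  have h := LinearMap.ker_inf_smul_top_eq_smul_of_flat I
    (f := (Ideal.Quotient.mkₐ S B).toLinearMap) (Ideal.Quotient.mkₐ_surjective S B)
  have hx2 : x ∈ I • (⊤ : Submodule S R) := by
    rw [Ideal.smul_top_eq_map]; exact hx.2
  have hx1 : x ∈ (Ideal.Quotient.mkₐ S B).toLinearMap.ker := by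
    simpa using Ideal.Quotient.eq_zero_iff_mem.2 hx.1
  have h3 := h.le ⟨hx1, hx2⟩
  refine Submodule.smul_induction_on h3 ?_ fun _ _ => Ideal.add_mem _
  intro r hr n hn
  rw [Algebra.smul_def]
  refine Ideal.mul_mem_mul (Ideal.mem_map_of_mem _ hr) ?_
  exact Ideal.Quotient.eq_zero_iff_mem.1 (by simpa using hn)

/-- Let `S` be a commutative ring with an ideal `𝔪`, let `R` be a commutative
`S`-algebra, and let `𝔱 = 𝔪R`. Let `b₀ ⊇ b₁ ⊇ ⋯ ⊇ b_m` be a decreasing chain of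
ideals of `R` with `R/b_p` flat over `S` for all `0 ≤ p ≤ m`, and set
`𝔍 = ∑_{j=0}^m 𝔱^j · b_{m-j}`. Then for every `0 ≤ ℓ ≤ m-1`,
`𝔱^ℓ ∩ (𝔱^(ℓ+1) + 𝔍) = 𝔱^ℓ ∩ (𝔱^(ℓ+1) + b_{m-ℓ})`. -/
theorem inf_sup_eq_of_flat_quotients {S R : Type*} [CommRing S] [CommRing R]
    [Algebra S R] (𝔪 : Ideal S) (m : ℕ) (hm : 1 ≤ m) (b : ℕ → Ideal R)
    (hb : ∀ p, p < m → b (p + 1) ≤ b p)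
    (hflat : ∀ p, p ≤ m → Module.Flat S (R ⧸ b p))
    (ℓ : ℕ) (hℓ : ℓ < m) :
    𝔪.map (algebraMap S R) ^ ℓ ⊓
        (𝔪.map (algebraMap S R) ^ (ℓ + 1) +
          ∑ j ∈ Finset.range (m + 1), 𝔪.map (algebraMap S R) ^ j * b (m - j)) =
      𝔪.map (algebraMap S R) ^ ℓ ⊓
        (𝔪.map (algebraMap S R) ^ (ℓ + 1) + b (m - ℓ)) := by
  set t := 𝔪.map (algebraMap S R) with ht
  have key : b (m - ℓ) ⊓ t ^ ℓ ≤ t ^ ℓ * b (m - ℓ) := by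
    have := hflat (m - ℓ) (Nat.sub_le _ _)
    rw [ht, ← Ideal.map_pow]
    exact inf_map_le_aux (𝔪 ^ ℓ) (b (m - ℓ))
  have hanti : ∀ p q, p ≤ q → q ≤ m → b q ≤ b p := by
    intro p q hpq
    induction q, hpq using Nat.le_induction with
    | base => intro _; exact le_rfl
    | succ n hn ih => intro h; exact (hb n (by omega)).trans (ih (by omega))
  simp only [Submodule.add_eq_sup]
  apply le_antisymm
  · refine inf_le_inf_left _ (sup_le le_sup_left ?_)
    rw [Ideal.sum_eq_sup]
    refine Finset.sup_le fun j hj => ?_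
    rcases Nat.lt_or_ge ℓ j with h | h
    · have h1 : t ^ j * b (m - j) ≤ t ^ j := Ideal.mul_le_left
      have h2 : t ^ j ≤ t ^ (ℓ + 1) := Ideal.pow_le_pow_right h
      exact le_sup_of_le_left (h1.trans h2)
    · have h1 : t ^ j * b (m - j) ≤ b (m - j) := Ideal.mul_le_right
      have h2 : b (m - j) ≤ b (m - ℓ) := hanti _ _ (by omega) (by omega)
      exact le_sup_of_le_right (h1.trans h2)
  · refine le_inf inf_le_left ?_
    rw [inf_comm, sup_inf_assoc_of_le _ (Ideal.pow_le_pow_right (Nat.le_succ ℓ))]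
    refine sup_le le_sup_left ((key.trans ?_).trans le_sup_right)
    rw [Ideal.sum_eq_sup]
    exact Finset.le_sup (f := fun j => t ^ j * b (m - j)) (Finset.mem_range.2 (by omega))
end

section
/- Let (S, 𝔪) be a regular local ring of Krull dimension d ≥ 1 with residue field k = S/𝔪, let R be a commutative S-algebra, and let 𝔱 = 𝔪R be the ideal of R generated by the image of 𝔪. Let b : ℕ → Ideal(R) be an antitone family of ideals (b_{p+1} ⊆ b_p for all p) with b_0 = R such that R/b_p is flat as an S-module for every p. Then for every natural number m ≥ 1, the length of the R-module R/(∑_{j=0}^{m} 𝔱^j · b_{m-j}) equals ∑_{ℓ=0}^{m-1} C(ℓ+d−1, d−1) · length_R(R/(𝔱 + b_{m-ℓ})), where C(·,·) is the binomial coefficient and the equality is of values in ℕ ∪ {∞} (with the convention that a positive natural number times ∞ is ∞). -/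
open Order IsLocalRing

namespace LQ
open RingTheory.Sequence Submodule Pointwise

section dom

lemma exchange {S : Type*} [CommRing S] [IsLocalRing S] (l : List S) :
    ∀ x, x ∈ Ideal.ofList l → x ∉ maximalIdeal S * Ideal.ofList l →
    ∃ l' : List S, l'.length + 1 = l.length ∧ Ideal.ofList l ≤ Ideal.span {x} ⊔ Ideal.ofList l' ∧
      Ideal.ofList l' ≤ Ideal.ofList l := by
  induction l with
  | nil =>
    intro x hx hn
    simp at hx
    subst hx
    exact absurd (zero_mem _) hn
  | cons y t ih =>
    intro x hx hn
    rw [Ideal.ofList_cons] at hx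
    obtain ⟨w, hw, z, hz, rfl⟩ := Submodule.mem_sup.1 hx
    obtain ⟨a, rfl⟩ := Ideal.mem_span_singleton'.1 hw
    by_cases ha : IsUnit a
    · refine ⟨t, by simp, ?_, by rw [Ideal.ofList_cons]; exact le_sup_right⟩
      rw [Ideal.ofList_cons]
      refine sup_le ?_ le_sup_right
      rw [Ideal.span_singleton_le_iff_mem]
      have h1 : a * y ∈ Ideal.span {a * y + z} ⊔ Ideal.ofList t := by
        have := Submodule.sub_mem (Ideal.span {a * y + z} ⊔ Ideal.ofList t)
          (Ideal.mem_sup_left (Ideal.mem_span_singleton_self (a*y+z))) (Ideal.mem_sup_right hz)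
        simpa using this
      exact (Ideal.unit_mul_mem_iff_mem _ ha).1 h1
    · have ham : a ∈ maximalIdeal S := ha
      have h2 : a * y ∈ maximalIdeal S * Ideal.ofList (y :: t) :=
        Ideal.mul_mem_mul ham (Ideal.subset_span (by simp))
      have hz2 : z ∉ maximalIdeal S * Ideal.ofList t := by
        intro h
        apply hn
        refine add_mem h2 (Ideal.mul_mono_right ?_ h)
        rw [Ideal.ofList_cons]; exact le_sup_right
      obtain ⟨t', ht', hle, hle2⟩ := ih z hz hz2
      refine ⟨y :: t', by simp [ht'], ?_, by rw [Ideal.ofList_cons, Ideal.ofList_cons]; exact sup_le_sup_left hle2 _⟩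
      rw [Ideal.ofList_cons, Ideal.ofList_cons]
      have hy : y ∈ Ideal.span {a * y + z} ⊔ (Ideal.span {y} ⊔ Ideal.ofList t') :=
        Ideal.mem_sup_right (Ideal.mem_sup_left (Ideal.mem_span_singleton_self y))
      refine sup_le ?_ (hle.trans (sup_le ?_ ?_))
      · rwa [Ideal.span_singleton_le_iff_mem]
      · rw [Ideal.span_singleton_le_iff_mem]
        have := Submodule.sub_mem _ 
          (Ideal.mem_sup_left (T := (Ideal.span {y} ⊔ Ideal.ofList t')) (Ideal.mem_span_singleton_self (a*y+z))) (Ideal.mul_mem_left _ a hy)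
        simpa using this
      · exact le_sup_right.trans le_sup_right

lemma dim_le {S : Type*} [CommRing S] [IsLocalRing S] [IsNoetherianRing S] (l : List S)
    (h : Ideal.ofList l = maximalIdeal S) : ringKrullDim S ≤ l.length := by
  refine (ringKrullDim_le_spanFinrank_maximalIdeal S).trans ?_
  rw [← h]
  classical
  have h1 : Ideal.ofList l = Submodule.span S (l.toFinset : Set S) := by
    simp [Ideal.ofList, Ideal.span]
  rw [h1]
  have := Submodule.spanFinrank_span_le_ncard_of_finite (R := S) (l.toFinset.finite_toSet)
  rw [Set.ncard_coe_finset] at this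
  exact_mod_cast this.trans (List.toFinset_card_le l)

lemma quot_local {S : Type*} [CommRing S] [IsLocalRing S] (x : S) (hx : x ∈ maximalIdeal S) :
    IsLocalRing (S ⧸ Ideal.span {x}) := by
  have : Nontrivial (S ⧸ Ideal.span {x}) := by
    apply Ideal.Quotient.nontrivial_iff.2
    intro h
    have : Ideal.span {x} ≤ maximalIdeal S := by rwa [Ideal.span_singleton_le_iff_mem]
    rw [h] at this
    exact (IsLocalRing.maximalIdeal.isMaximal S).ne_top (top_le_iff.1 this)
  exact IsLocalRing.of_surjective' (Ideal.Quotient.mk _) Ideal.Quotient.mk_surjective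

lemma quot_max {S : Type*} [CommRing S] [IsLocalRing S] (x : S)
    [IsLocalRing (S ⧸ Ideal.span {x})] (l : List S)
    (h : Ideal.span {x} ⊔ Ideal.ofList l = maximalIdeal S) :
    Ideal.ofList (l.map (Ideal.Quotient.mk (Ideal.span {x}))) = maximalIdeal (S ⧸ Ideal.span {x}) := by
  rw [← Ideal.map_ofList]
  have h0 : Ideal.map (Ideal.Quotient.mk (Ideal.span {x})) (Ideal.span {x}) = ⊥ := Ideal.map_quotient_self _
  have h1 : Ideal.map (Ideal.Quotient.mk (Ideal.span {x})) (Ideal.ofList l) =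
     Ideal.map (Ideal.Quotient.mk (Ideal.span {x})) (maximalIdeal S) := by
    rw [← h, Ideal.map_sup, h0, bot_sup_eq]
  rw [h1]
  have := IsLocalRing.eq_maximalIdeal (R := S ⧸ Ideal.span {x}) 
    (I := Ideal.map (Ideal.Quotient.mk (Ideal.span {x})) (maximalIdeal S)) ?_
  · exact this
  · refine (Ideal.map_eq_top_or_isMaximal_of_surjective _ Ideal.Quotient.mk_surjective
      (IsLocalRing.maximalIdeal.isMaximal S)).resolve_left ?_
    intro ht
    have h3 := congrArg (Ideal.comap (Ideal.Quotient.mk (Ideal.span {x}))) ht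
    rw [Ideal.comap_map_of_surjective _ Ideal.Quotient.mk_surjective, Ideal.comap_top,
      ← RingHom.ker_eq_comap_bot, Ideal.mk_ker, ← h] at h3
    have h4 : Ideal.span {x} ⊔ Ideal.ofList l ⊔ Ideal.span {x} = maximalIdeal S := by
      rw [← h]; exact sup_eq_left.2 le_sup_left
    rw [h4] at h3
    exact (IsLocalRing.maximalIdeal.isMaximal S).ne_top h3

lemma quot_dim {S : Type*} [CommRing S] [IsLocalRing S] [IsNoetherianRing S] (x : S) 
    (hx : x ∈ maximalIdeal S) (d : ℕ) (hd : ((d + 1 : ℕ) : WithBot ℕ∞) ≤ ringKrullDim S) :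
    (d : WithBot ℕ∞) ≤ ringKrullDim (S ⧸ Ideal.span {x}) := by
  have h1 := ringKrullDim_le_ringKrullDim_quotSMulTop_succ hx
  have h : Ideal.span {x} = x • (⊤ : Ideal S) := by simp [← Submodule.ideal_span_singleton_smul]
  rw [h]
  have h2 := hd.trans h1
  push_cast at h2
  exact ENat.WithBot.add_le_add_one_right_iff.1 h2

theorem isDomain_aux (d : ℕ) : ∀ {S : Type*} [CommRing S] [IsLocalRing S] [IsNoetherianRing S]
    (_ : (d : WithBot ℕ∞) ≤ ringKrullDim S) (l : List S) (_ : l.length = d)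
    (_ : Ideal.ofList l = maximalIdeal S), IsDomain S := by
  induction d with
  | zero =>
    intro S _ _ _ _ l hl h
    have : l = [] := by simpa using hl
    subst this
    rw [Ideal.ofList_nil] at h
    exact (IsLocalRing.isField_iff_maximalIdeal_eq.2 h.symm).isDomain
  | succ d ih =>
    intro S _ _ _ hd l hl h
    have hfin : (minimalPrimes S).Finite := minimalPrimes.finite_of_isNoetherianRing S
    have key : ∃ x ∈ maximalIdeal S, x ∉ maximalIdeal S * maximalIdeal S ∧
        ∀ P ∈ minimalPrimes S, x ∉ P := by
      by_contra! hc
      have hsub : ((maximalIdeal S : Ideal S) : Set S) ⊆ 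
          ((id (maximalIdeal S * maximalIdeal S) : Ideal S) : Set S) ∪ (id (maximalIdeal S * maximalIdeal S) : Ideal S)
          ∪ ⋃ i ∈ (↑hfin.toFinset : Set (Ideal S)), (id i : Ideal S) := by
        intro x hx
        by_cases hxm : x ∈ maximalIdeal S * maximalIdeal S
        · exact Or.inl (Or.inl hxm)
        · obtain ⟨P, hP, hxP⟩ := hc x hx hxm
          right
          simp only [Set.mem_iUnion]
          exact ⟨P, by simpa using hP, hxP⟩
      rw [Ideal.subset_union_prime' (f := id) (by
        intro i hi
        have : i ∈ minimalPrimes S := by simpa using hi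
        exact this.1.1)] at hsub
      have hmm : ¬ maximalIdeal S ≤ maximalIdeal S * maximalIdeal S := by
        intro hle
        have hb : maximalIdeal S = ⊥ := 
          Submodule.eq_bot_of_le_smul_of_le_jacobson_bot (maximalIdeal S) (maximalIdeal S)
            (IsNoetherian.noetherian _) hle (IsLocalRing.maximalIdeal_le_jacobson _)
        have := dim_le (S := S) [] (by simp [hb])
        have := hd.trans this
        simp at this
      rcases hsub with h1 | h1 | ⟨P, hP, h1⟩
      · exact hmm h1
      · exact hmm h1
      · have hP' : P ∈ minimalPrimes S := by simpa using hP
        have hPp := hP'.1.1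
        have hPm : P = maximalIdeal S := le_antisymm (IsLocalRing.le_maximalIdeal hPp.ne_top) h1
        have hh : P.height = 0 := by
          exact Ideal.height_eq_zero_iff.2 hP'
        have h5 := IsLocalRing.maximalIdeal_height_eq_ringKrullDim (R := S)
        rw [← hPm, hh] at h5
        rw [← h5] at hd
        norm_cast at hd
    obtain ⟨x, hxm, hx2, hxP⟩ := key
    obtain ⟨l', hl', hle, hle2⟩ := exchange l x (h ▸ hxm) (h ▸ hx2)
    have hgen : Ideal.span {x} ⊔ Ideal.ofList l' = maximalIdeal S := by
      refine le_antisymm (sup_le ?_ (h ▸ hle2)) (h ▸ hle)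
      rwa [Ideal.span_singleton_le_iff_mem]
    have := quot_local x hxm
    have hdom := ih (quot_dim x hxm d hd) _ (by simp; omega) (quot_max x l' hgen)
    have hprime : (Ideal.span {x}).IsPrime := (Ideal.Quotient.isDomain_iff_prime _).1 hdom
    obtain ⟨P, hP, hPx⟩ := Ideal.exists_minimalPrimes_le (I := ⊥) (J := Ideal.span {x}) bot_le
    have hPp : P.IsPrime := hP.1.1
    have hP0 : P = ⊥ := by
      refine Submodule.eq_bot_of_le_smul_of_le_jacobson_bot (Ideal.span {x}) P
            (IsNoetherian.noetherian _) ?_ ?_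
      · intro z hz
        obtain ⟨a, rfl⟩ := Ideal.mem_span_singleton'.1 (hPx hz)
        have ha : a ∈ P := (hPp.mem_or_mem hz).resolve_right (hxP P hP)
        rw [mul_comm]
        exact Ideal.mul_mem_mul (Ideal.mem_span_singleton_self x) ha
      · refine le_trans ?_ (IsLocalRing.maximalIdeal_le_jacobson _)
        rwa [Ideal.span_singleton_le_iff_mem]
    rw [hP0] at hPp
    exact IsDomain.of_bot_isPrime S

theorem isWeaklyRegular_aux (d : ℕ) : ∀ {S : Type*} [CommRing S] [IsLocalRing S] [IsNoetherianRing S]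
    (_ : (d : WithBot ℕ∞) ≤ ringKrullDim S) (l : List S) (_ : l.length = d)
    (_ : Ideal.ofList l = maximalIdeal S), IsWeaklyRegular S l := by
  induction d with
  | zero =>
    intro S _ _ _ _ l hl h
    have : l = [] := by simpa using hl
    subst this
    exact IsWeaklyRegular.nil _ _
  | succ d ih =>
    intro S _ _ _ hd l hl h
    have hdom := isDomain_aux (d + 1) hd l hl h
    obtain ⟨x, t, rfl⟩ : ∃ x t, l = x :: t := List.exists_cons_of_length_eq_add_one hl
    have ht : t.length = d := by simpa using hl
    rw [Ideal.ofList_cons] at h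
    have hxm : x ∈ maximalIdeal S := by
      rw [← h]; exact Ideal.mem_sup_left (Ideal.mem_span_singleton_self x)
    have hx0 : x ≠ 0 := by
      rintro rfl
      have := hd.trans (dim_le t (by simpa using h))
      rw [ht] at this
      norm_cast at this
      omega
    have := quot_local x hxm
    have h1 := ih (quot_dim x hxm d hd) _ (by simpa using ht) (quot_max x t h)
    have h2 : IsWeaklyRegular (S ⧸ Ideal.span {x}) t :=
      (isWeaklyRegular_map_algebraMap_iff (S := S ⧸ Ideal.span {x}) (S ⧸ Ideal.span {x}) t).1 h1
    rw [isWeaklyRegular_cons_iff]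
    refine ⟨?_, ?_⟩
    · intro a b hab
      exact mul_left_cancel₀ hx0 hab
    · have h : Ideal.span {x} = x • (⊤ : Ideal S) := by
        simp [← Submodule.ideal_span_singleton_smul]
      exact ((Submodule.quotEquivOfEq _ _ h).isWeaklyRegular_congr t).1 h2

end dom

/-- weakly regular in every order -/
def PR {R : Type*} [CommRing R] (M : Type*) [AddCommGroup M] [Module R M] (l : List R) : Prop :=
  ∀ l' : List R, l'.Perm l → IsWeaklyRegular M l'

section
variable {R : Type*} [CommRing R] 

lemma PR.perm {M : Type*} [AddCommGroup M] [Module R M] {l l' : List R} (h : PR M l) (hp : l'.Perm l) :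
    PR M l' := fun _ h2 => h _ (h2.trans hp)

lemma PR.quot {M : Type*} [AddCommGroup M] [Module R M] {x : R} {l : List R} (h : PR M (x :: l)) :
    PR (QuotSMulTop x M) l := fun l' h2 => 
  ((isWeaklyRegular_cons_iff M x l').1 (h _ (h2.cons x))).2

lemma PR.reg {M : Type*} [AddCommGroup M] [Module R M] {x : R} {l : List R} (h : PR M (x :: l)) :
    IsSMulRegular M x :=
  ((isWeaklyRegular_cons_iff M x l).1 (h _ (List.Perm.refl _))).1

lemma PR.tail {M : Type*} [AddCommGroup M] [Module R M] {x : R} {l : List R} (h : PR M (x :: l)) :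
    PR M l := fun l' h2 => 
  ((isWeaklyRegular_append_iff M l' [x]).1 (h _ 
    ((List.perm_append_singleton x l').trans (h2.cons x)))).1

lemma pow_decomp (x : R) (J : Ideal R) (n : ℕ) :
    (Ideal.span {x} ⊔ J) ^ (n + 1) = J ^ (n + 1) ⊔ Ideal.span {x} * (Ideal.span {x} ⊔ J) ^ n := by
  induction n with
  | zero => simp [sup_comm]
  | succ n ih =>
    apply le_antisymm
    · rw [pow_succ', Ideal.sup_mul]
      refine sup_le le_sup_right ?_
      conv_lhs => rw [ih]
      rw [Ideal.mul_sup, ← pow_succ']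
      refine sup_le le_sup_left (le_trans ?_ le_sup_right)
      rw [mul_left_comm]
      refine Ideal.mul_mono_right ?_
      rw [pow_succ']
      exact Ideal.mul_mono_left le_sup_right
    · refine sup_le (Ideal.pow_right_mono le_sup_right _) ?_
      rw [pow_succ' _ (n+1)]
      exact Ideal.mul_mono_left le_sup_left

variable {M : Type*} [AddCommGroup M] [Module R M]

lemma mem_pow_iff (x : R) (J : Ideal R) (n : ℕ) (s : M) :
    s ∈ ((Ideal.span {x} ⊔ J) ^ (n + 1) • ⊤ : Submodule R M) ↔ 
    ∃ a ∈ (J ^ (n + 1) • ⊤ : Submodule R M), 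
      ∃ u ∈ ((Ideal.span {x} ⊔ J) ^ n • ⊤ : Submodule R M), s = a + x • u := by
  rw [pow_decomp, Submodule.sup_smul, Submodule.mul_smul, Submodule.mem_sup]
  constructor
  · rintro ⟨a, ha, z, hz, rfl⟩
    rw [Submodule.ideal_span_singleton_smul] at hz
    obtain ⟨u, hu, rfl⟩ := (Submodule.mem_smul_pointwise_iff_exists _ _ _).1 hz
    exact ⟨a, ha, u, hu, rfl⟩
  · rintro ⟨a, ha, u, hu, rfl⟩
    exact ⟨a, ha, x • u, Submodule.smul_mem_smul (Ideal.mem_span_singleton_self x) hu, rfl⟩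

lemma mem_quot_iff (x : R) (J : Ideal R) (s : M) :
    (mkQ (x • (⊤ : Submodule R M)) s) ∈ (J • ⊤ : Submodule R (QuotSMulTop x M)) ↔ 
    ∃ a ∈ (J • ⊤ : Submodule R M), ∃ u : M, s = a + x • u := by
  have h1 : (J • ⊤ : Submodule R (QuotSMulTop x M)) = 
      (J • ⊤ : Submodule R M).map (mkQ (x • (⊤ : Submodule R M))) := by
    rw [Submodule.map_smul'', Submodule.map_top, Submodule.range_mkQ]
  rw [h1, Submodule.mem_map]
  constructor
  · rintro ⟨a, ha, h⟩
    have h2 : s - a ∈ x • (⊤ : Submodule R M) := (Submodule.Quotient.eq _).1 h.symm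
    obtain ⟨u, -, hu⟩ := (Submodule.mem_smul_pointwise_iff_exists _ _ _).1 h2
    exact ⟨a, ha, u, by rw [hu]; abel⟩
  · rintro ⟨a, ha, u, rfl⟩
    refine ⟨a, ha, ?_⟩
    refine (Submodule.Quotient.eq _).2 ?_
    refine (Submodule.mem_smul_pointwise_iff_exists _ _ _).2 ⟨-u, trivial, ?_⟩
    rw [smul_neg]; abel

lemma pow_smul_mono {I J : Ideal R} (h : I ≤ J) (n : ℕ) : 
    (I ^ n • ⊤ : Submodule R M) ≤ J ^ n • ⊤ :=
  Submodule.smul_mono_left (Ideal.pow_right_mono h n)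

lemma pow_smul_anti (I : Ideal R) (n : ℕ) : 
    (I ^ (n+1) • ⊤ : Submodule R M) ≤ I ^ n • ⊤ :=
  Submodule.smul_mono_left (Ideal.pow_le_pow_right (Nat.le_succ n))

lemma reg_pow {M : Type*} [AddCommGroup M] [Module R M] (l : List R) (y : R) (h : PR M (y :: l)) 
    (n : ℕ) (s : M)
    (hs : y • s ∈ ((Ideal.ofList l) ^ n • ⊤ : Submodule R M)) : 
    s ∈ ((Ideal.ofList l) ^ n • ⊤ : Submodule R M) := by
  induction l generalizing M y n with
  | nil =>
    cases n with
    | zero => simp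
    | succ n =>
      rw [Ideal.ofList_nil, ← Ideal.zero_eq_bot, zero_pow (Nat.succ_ne_zero n), Ideal.zero_eq_bot,
        Submodule.bot_smul, Submodule.mem_bot] at *
      exact h.reg (by simpa using hs)
  | cons x t ih =>
    have hx : ∀ n (s : M), x • s ∈ ((Ideal.ofList t) ^ n • ⊤ : Submodule R M) → 
        s ∈ ((Ideal.ofList t) ^ n • ⊤ : Submodule R M) := fun n s h3 => ih x h.tail n s h3
    have hq : PR (QuotSMulTop x M) (y :: t) := PR.quot (h.perm (List.Perm.swap y x t))
    rw [Ideal.ofList_cons] at *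
    set J := Ideal.ofList t
    induction n generalizing s with
    | zero => simp
    | succ n ihn =>
      have hsn := ihn s (pow_smul_anti _ _ hs)
      have hdec : ∃ j ∈ (J ^ n • ⊤ : Submodule R M), ∃ i, s = j + x • i := by
        cases n with
        | zero => exact ⟨s, by simp, 0, by simp⟩
        | succ n =>
          obtain ⟨a, ha, u, hu, rfl⟩ := (mem_pow_iff _ _ _ _).1 hsn
          exact ⟨a, ha, u, rfl⟩
      obtain ⟨j, hj, i, rfl⟩ := hdec
      obtain ⟨j', hj', i', hi', he⟩ := (mem_pow_iff _ _ _ _).1 hs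
      have h1 : x • (y • i - i') ∈ (J ^ n • ⊤ : Submodule R M) := by
        have : x • (y • i - i') = j' - y • j := by
          rw [smul_add, smul_comm y x i] at he
          rw [smul_sub, sub_eq_sub_iff_add_eq_add, add_comm, he]
        rw [this]
        exact sub_mem (pow_smul_anti _ _ hj') (Submodule.smul_mem _ _ hj)
      have h2 := add_mem (pow_smul_mono (le_sup_right : J ≤ Ideal.span {x} ⊔ J) n (hx _ _ h1)) hi'
      rw [sub_add_cancel] at h2
      have hi := ihn i h2
      have hxi : x • i ∈ ((Ideal.span {x} ⊔ J) ^ (n+1) • ⊤ : Submodule R M) :=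
        (mem_pow_iff _ _ _ _).2 ⟨0, zero_mem _, i, hi, by simp⟩
      have hyj : mkQ (x • (⊤ : Submodule R M)) (y • j) ∈ 
          (J ^ (n+1) • ⊤ : Submodule R (QuotSMulTop x M)) := by
        rw [mem_quot_iff]
        refine ⟨j', hj', i' - y • i, ?_⟩
        rw [smul_sub, ← add_sub_assoc, ← he, smul_add, smul_comm x y i]
        abel
      rw [map_smul] at hyj
      have hjq := ih y hq _ _ hyj
      obtain ⟨a, ha, u, rfl⟩ := (mem_quot_iff _ _ _).1 hjq
      have hu : u ∈ (J ^ n • ⊤ : Submodule R M) := by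
        apply hx
        have := sub_mem hj (pow_smul_anti _ _ ha)
        rwa [add_sub_cancel_left] at this
      refine add_mem ?_ hxi
      exact (mem_pow_iff _ _ _ _).2 ⟨a, ha, u, pow_smul_mono le_sup_right n hu, rfl⟩

lemma reg_pow' {x : R} {t : List R} (h : PR M (x :: t)) (n : ℕ) (s : M) 
    (hs : x • s ∈ ((Ideal.ofList (x :: t)) ^ (n + 1) • ⊤ : Submodule R M)) : 
    s ∈ ((Ideal.ofList (x :: t)) ^ n • ⊤ : Submodule R M) := by
  rw [Ideal.ofList_cons] at *
  obtain ⟨a, ha, u, hu, he⟩ := (mem_pow_iff _ _ _ _).1 hs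
  have h1 : s - u ∈ ((Ideal.ofList t) ^ (n+1) • ⊤ : Submodule R M) := by
    apply reg_pow t x h
    rw [smul_sub, he]; simpa using ha
  have := add_mem (pow_smul_mono le_sup_right _ (pow_smul_anti _ _ h1)) hu
  rwa [sub_add_cancel] at this

/-! lengths -/

lemma length_map_add {Q Q' : Type*} [AddCommGroup Q] [Module R Q] [AddCommGroup Q'] [Module R Q']
    (q : Q →ₗ[R] Q') (X : Submodule R Q) :
    Module.length R X = Module.length R (X ⊓ LinearMap.ker q : Submodule R Q) + 
      Module.length R (X.map q) := by
  have hm : ∀ c ∈ X, q c ∈ X.map q := fun c hc => Submodule.mem_map_of_mem hc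
  refine Module.length_eq_add_of_exact (Submodule.inclusion (inf_le_left)) 
    (q.restrict hm) (Submodule.inclusion_injective _) ?_ ?_
  · rintro ⟨_, c, hc, rfl⟩
    exact ⟨⟨c, hc⟩, rfl⟩
  · intro ⟨c, hc⟩
    constructor
    · intro h
      have : q c = 0 := congrArg Subtype.val h
      exact ⟨⟨c, hc, this⟩, rfl⟩
    · rintro ⟨⟨c', hc', h⟩, he⟩
      obtain rfl : c' = c := congrArg Subtype.val he
      exact Subtype.ext h

lemma length_map_inj {Q Q' : Type*} [AddCommGroup Q] [Module R Q] [AddCommGroup Q'] [Module R Q']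
    (q : Q →ₗ[R] Q') (hq : Function.Injective q) (X : Submodule R Q) :
    Module.length R (X.map q) = Module.length R X :=
  ((Submodule.equivMapOfInjective q hq X).length_eq).symm

lemma length_range_eq {P Q Q' : Type*} [AddCommGroup P] [Module R P]
    [AddCommGroup Q] [Module R Q] [AddCommGroup Q'] [Module R Q']
    (f : P →ₗ[R] Q) (g : P →ₗ[R] Q') (h : LinearMap.ker f = LinearMap.ker g) :
    Module.length R (LinearMap.range f) = Module.length R (LinearMap.range g) :=
  (f.quotKerEquivRange.symm.trans ((Submodule.quotEquivOfEq _ _ h).trans g.quotKerEquivRange)).length_eq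

/-- length of `I^n M / I^(n+1) M` -/
noncomputable def gl (I : Ideal R) (n : ℕ) (M : Type*) [AddCommGroup M] [Module R M] : ℕ∞ :=
  Module.length R ((I ^ n • ⊤ : Submodule R M).map (mkQ (I ^ (n+1) • ⊤ : Submodule R M)))

lemma gl_step {x : R} {t : List R} (h : PR M (x :: t)) (n : ℕ) :
    gl (Ideal.ofList (x :: t)) (n+1) M = 
      gl (Ideal.ofList t) (n+1) (QuotSMulTop x M) + gl (Ideal.ofList (x :: t)) n M := by
  have hF2 := reg_pow' h
  unfold gl
  rw [Ideal.ofList_cons] at *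
  set J := Ideal.ofList t
  set I := Ideal.span {x} ⊔ J with hI
  let q : (M ⧸ (I ^ (n+1+1) • ⊤ : Submodule R M)) →ₗ[R] 
      (QuotSMulTop x M ⧸ (J ^ (n+1+1) • ⊤ : Submodule R (QuotSMulTop x M))) :=
    Submodule.mapQ _ _ (mkQ (x • (⊤ : Submodule R M))) (by
      intro s hs
      obtain ⟨a, ha, u, hu, rfl⟩ := (mem_pow_iff _ _ _ _).1 hs
      exact (mem_quot_iff _ _ _).2 ⟨a, ha, u, rfl⟩)
  let f : (M ⧸ (I ^ (n+1) • ⊤ : Submodule R M)) →ₗ[R] (M ⧸ (I ^ (n+1+1) • ⊤ : Submodule R M)) :=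
    Submodule.mapQ _ _ (LinearMap.lsmul R M x) (by
      intro s hs
      exact (mem_pow_iff _ _ _ _).2 ⟨0, zero_mem _, s, hs, by simp⟩)
  have hf : Function.Injective f := by
    rw [← LinearMap.ker_eq_bot, LinearMap.ker_eq_bot']
    intro z hz
    obtain ⟨s, rfl⟩ := mkQ_surjective _ z
    have : x • s ∈ (I ^ (n+1+1) • ⊤ : Submodule R M) := (Submodule.Quotient.mk_eq_zero _).1 hz
    exact (Submodule.Quotient.mk_eq_zero _).2 (hF2 _ _ this)
  rw [length_map_add q, add_comm, 
    ← length_map_inj f hf ((I ^ n • ⊤ : Submodule R M).map (mkQ (I ^ (n+1) • ⊤ : Submodule R M)))]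
  congr 1
  · apply congrArg (fun X : Submodule R _ => Module.length R X)
    ext z
    constructor
    · rintro ⟨_, ⟨s, hs, rfl⟩, rfl⟩
      obtain ⟨a, ha, u, hu, rfl⟩ := (mem_pow_iff _ _ _ _).1 hs
      exact ⟨mkQ _ (a + x • u), (mem_quot_iff _ _ _).2 ⟨a, ha, u, rfl⟩, rfl⟩
    · rintro ⟨w, hw, rfl⟩
      obtain ⟨s, rfl⟩ := mkQ_surjective _ w
      obtain ⟨a, ha, u, rfl⟩ := (mem_quot_iff _ _ _).1 hw
      refine ⟨mkQ _ a, ⟨a, pow_smul_mono le_sup_right _ ha, rfl⟩, ?_⟩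
      change mkQ _ (mkQ _ a) = _
      congr 1
      refine (Submodule.Quotient.eq _).2 ?_
      refine (Submodule.mem_smul_pointwise_iff_exists _ _ _).2 ⟨-u, trivial, ?_⟩
      rw [smul_neg]; abel
  · apply congrArg (fun X : Submodule R _ => Module.length R X)
    ext z
    constructor
    · rintro ⟨⟨s, hs, rfl⟩, hz⟩
      have hz' : mkQ (x • (⊤ : Submodule R M)) s ∈ (J ^ (n+1+1) • ⊤ : Submodule R (QuotSMulTop x M)) := 
        (Submodule.Quotient.mk_eq_zero _).1 hz
      obtain ⟨a, ha, u, rfl⟩ := (mem_quot_iff _ _ _).1 hz'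
      have hxu : x • u ∈ (I ^ (n+1) • ⊤ : Submodule R M) := by
        have := sub_mem hs (pow_smul_mono le_sup_right _ (pow_smul_anti _ _ ha))
        rwa [add_sub_cancel_left] at this
      refine ⟨mkQ _ u, ⟨u, hF2 _ _ hxu, rfl⟩, ?_⟩
      refine (Submodule.Quotient.eq _).2 ?_
      have := neg_mem (pow_smul_mono (M := M) (le_sup_right : J ≤ I) _ ha)
      simpa using this
    · rintro ⟨_, ⟨u, hu, rfl⟩, rfl⟩
      refine ⟨⟨x • u, (mem_pow_iff _ _ _ _).2 ⟨0, zero_mem _, u, hu, by simp⟩, rfl⟩, ?_⟩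
      refine (Submodule.Quotient.mk_eq_zero _).2 ?_
      exact (mem_quot_iff _ _ _).2 ⟨0, zero_mem _, u, by simp⟩

theorem gl_eq {M : Type*} [AddCommGroup M] [Module R M] (l : List R) (h : PR M l) (n : ℕ) :
    gl (Ideal.ofList l) n M = (Nat.multichoose l.length n : ℕ∞) * 
      Module.length R (M ⧸ (Ideal.ofList l • ⊤ : Submodule R M)) := by
  have h0 : ∀ I : Ideal R, gl I 0 M = Module.length R (M ⧸ (I • ⊤ : Submodule R M)) := by
    intro I
    unfold gl
    rw [pow_zero, Ideal.one_eq_top, Submodule.top_smul, Submodule.map_top, range_mkQ, Module.length_top,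
      zero_add, pow_one]
  induction l generalizing M n with
  | nil =>
    cases n with
    | zero => rw [h0, Nat.multichoose_zero_right, Nat.cast_one, one_mul]
    | succ n => 
      simp only [List.length_nil, Nat.multichoose_zero_succ, Nat.cast_zero, zero_mul]
      unfold gl
      rw [Ideal.ofList_nil, ← Ideal.zero_eq_bot, zero_pow (Nat.succ_ne_zero n), Ideal.zero_eq_bot,
        Submodule.bot_smul, Submodule.map_bot, Module.length_bot]
  | cons x t ih =>
    induction n with
    | zero => rw [h0, Nat.multichoose_zero_right, Nat.cast_one, one_mul]
    | succ n ihn =>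
      rw [gl_step h, ihn, ih h.quot, List.length_cons, Nat.multichoose_succ_succ, Nat.cast_add, add_mul,
        (quotOfListConsSMulTopEquivQuotSMulTopInner M x t).length_eq]
      intro I
      unfold gl
      rw [pow_zero, Ideal.one_eq_top, Submodule.top_smul, Submodule.map_top, range_mkQ, Module.length_top,
        zero_add, pow_one]
end

lemma perm_map_aux {α β : Type*} (f : α → β) {a c : List β} (h : a.Perm c) :
    ∀ l : List α, c = l.map f → ∃ l' : List α, l'.Perm l ∧ a = l'.map f := by
  induction h with
  | nil =>
    intro l hl
    exact ⟨[], by simpa using hl.symm, rfl⟩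
  | cons x h ih =>
    intro l hl
    match l, hl with
    | y :: t, hl =>
      simp only [List.map_cons, List.cons.injEq] at hl
      obtain ⟨rfl, h2⟩ := hl
      obtain ⟨t', ht', rfl⟩ := ih _ h2
      exact ⟨y :: t', ht'.cons y, rfl⟩
  | swap x y t =>
    intro l hl
    match l, hl with
    | u :: v :: w, hl =>
      simp only [List.map_cons, List.cons.injEq] at hl
      obtain ⟨rfl, rfl, rfl⟩ := hl
      exact ⟨v :: u :: w, List.Perm.swap _ _ _, rfl⟩
  | trans _ _ ih1 ih2 =>
    intro l hl
    obtain ⟨l', h1, h2⟩ := ih2 l hl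
    obtain ⟨l'', h3, h4⟩ := ih1 l' h2
    exact ⟨l'', h3.trans h1, h4⟩

section flat
variable {S : Type*} [CommRing S] {R : Type*} [CommRing R] [Algebra S R]

set_option maxHeartbeats 2000000 in
lemma flat_inter (b : Ideal R) (hf : Module.Flat S (R ⧸ b)) (I : Ideal S) (z : R)
    (hz : z ∈ I.map (algebraMap S R)) (hzb : z ∈ b) : z ∈ I.map (algebraMap S R) * b := by
  have h1 : z ∈ (I • ⊤ : Submodule S R) := by
    rw [Ideal.smul_top_eq_map]; exact hz
  have h2 : z ∈ (I • Submodule.span S (Set.range (id : R → R))) := by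
    rw [Set.range_id, Submodule.span_univ]; exact h1
  obtain ⟨a, ha, hsum⟩ := (Submodule.mem_ideal_smul_span_iff_exists_sum _ _ _).1 h2
  have hsum' : ∑ i : a.support, a (i : R) • (i : R) = z := by
    rw [← hsum]
    exact Finset.sum_coe_sort a.support (fun i => a i • i)
  have hq : ∑ i : a.support, a (i : R) • (Ideal.Quotient.mkₐ S b (i : R)) = 0 := by
    have h := congrArg (Ideal.Quotient.mkₐ S b) hsum'
    have h0 : Ideal.Quotient.mkₐ S b z = 0 := Ideal.Quotient.eq_zero_iff_mem.2 hzb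
    rw [h0, map_sum] at h
    simpa only [map_smul] using h
  obtain ⟨k, c, y, hc, hc0⟩ := Module.Flat.isTrivialRelation_of_sum_smul_eq_zero (R := S) (M := R ⧸ b)
    (f := fun i : a.support => a (i : R)) (x := fun i : a.support => Ideal.Quotient.mkₐ S b (i : R)) hq
  beta_reduce at hc hc0
  choose w hw using fun j => Ideal.Quotient.mk_surjective (I := b) (y j)
  have hb : ∀ i : a.support, (i : R) - ∑ j, c i j • w j ∈ b := by
    intro i
    rw [← Ideal.Quotient.eq]
    change Ideal.Quotient.mkₐ S b (i : R) = Ideal.Quotient.mkₐ S b (∑ j, c i j • w j)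
    rw [hc i, map_sum]
    refine Finset.sum_congr rfl fun j _ => ?_
    rw [map_smul, ← hw j]; rfl
  have hz2 : z = ∑ i : a.support, a i • ((i : R) - ∑ j, c i j • w j) := by
    simp only [smul_sub, Finset.sum_sub_distrib, hsum', Finset.smul_sum]
    rw [Finset.sum_comm]
    simp only [smul_smul, ← Finset.sum_smul, hc0]
    simp
  rw [hz2]
  refine Ideal.sum_mem _ fun i _ => ?_
  rw [Algebra.smul_def]
  exact Ideal.mul_mem_mul (Ideal.mem_map_of_mem _ (ha i)) (hb i)

lemma PR_flat {M : Type*} [AddCommGroup M] [Module S M] [Module R M] [IsScalarTower S R M]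
    [Module.Flat S M] (l : List S) (h : PR S l) : PR M (l.map (algebraMap S R)) := by
  intro l' hl'
  obtain ⟨l'', h1, rfl⟩ := perm_map_aux _ hl' l rfl
  rw [isWeaklyRegular_map_algebraMap_iff]
  exact ((TensorProduct.rid S M).isWeaklyRegular_congr l'').1
    (IsWeaklyRegular.isWeaklyRegular_lTensor (M₂ := M) (h _ h1))

end flat

section filt
variable {R : Type*} [CommRing R]

lemma filt_step (t J b : Ideal R) (n : ℕ) (h1 : J ≤ t ^ (n+1) ⊔ b) 
    (h2 : ∀ z ∈ t ^ n, z ∈ b → z ∈ J) :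
    Module.length R (R ⧸ (t ^ (n+1) ⊔ J)) = gl t n (R ⧸ b) + Module.length R (R ⧸ (t ^ n ⊔ J)) := by
  have hle : t ^ (n+1) ⊔ J ≤ t ^ n ⊔ J := sup_le_sup_right (Ideal.pow_le_pow_right n.le_succ) _
  let q : (R ⧸ (t ^ (n+1) ⊔ J)) →ₗ[R] (R ⧸ (t ^ n ⊔ J)) := Submodule.factor hle
  have hq : LinearMap.range q = ⊤ := LinearMap.range_eq_top.2 (Submodule.factor_surjective hle)
  rw [← Module.length_top (M := R ⧸ (t ^ (n+1) ⊔ J)), length_map_add q ⊤, Submodule.map_top, hq,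
    Module.length_top]
  congr 1
  let f : (t ^ n : Ideal R) →ₗ[R] (R ⧸ (t ^ (n+1) ⊔ J)) := (Submodule.mkQ _).comp (t ^ n).subtype
  let g : (t ^ n : Ideal R) →ₗ[R] ((R ⧸ b) ⧸ (t ^ (n+1) • ⊤ : Submodule R (R ⧸ b))) := 
    ((Submodule.mkQ _).comp (Submodule.mkQ b)).comp (t ^ n).subtype
  have hpow : ∀ k, (t ^ k • ⊤ : Submodule R (R ⧸ b)) = Submodule.map (Submodule.mkQ b) (t ^ k) := by
    intro k
    have : (t ^ k : Submodule R R) = t ^ k • ⊤ := by simp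
    conv_rhs => rw [this]
    rw [Submodule.map_smul'', Submodule.map_top, Submodule.range_mkQ]
  have hf : (⊤ ⊓ LinearMap.ker q) = LinearMap.range f := by
    ext z
    constructor
    · rintro ⟨-, hz⟩
      obtain ⟨s, rfl⟩ := Submodule.mkQ_surjective _ z
      have hs : s ∈ t ^ n ⊔ J := (Submodule.Quotient.mk_eq_zero _).1 hz
      obtain ⟨a, ha, c, hc, rfl⟩ := Submodule.mem_sup.1 hs
      refine ⟨⟨a, ha⟩, ?_⟩
      refine (Submodule.Quotient.eq _).2 ?_
      refine Submodule.mem_sup_right ?_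
      simpa using hc
    · rintro ⟨⟨a, ha⟩, rfl⟩
      exact ⟨trivial, (Submodule.Quotient.mk_eq_zero _).2 (Submodule.mem_sup_left ha)⟩
  have hg : (t ^ n • ⊤ : Submodule R (R ⧸ b)).map (mkQ (t ^ (n+1) • ⊤ : Submodule R (R ⧸ b))) = 
      LinearMap.range g := by
    rw [hpow n, LinearMap.range_comp, Submodule.range_subtype, Submodule.map_comp]
  unfold gl
  rw [hf, hg]
  apply length_range_eq
  ext ⟨a, ha⟩
  have e1 : f ⟨a, ha⟩ = 0 ↔ a ∈ t ^ (n+1) ⊔ J := Submodule.Quotient.mk_eq_zero _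
  have e2 : g ⟨a, ha⟩ = 0 ↔ a ∈ t ^ (n+1) ⊔ b := by
    have : g ⟨a, ha⟩ = 0 ↔ Submodule.mkQ b a ∈ (t ^ (n+1) • ⊤ : Submodule R (R ⧸ b)) := 
      Submodule.Quotient.mk_eq_zero _
    rw [this, hpow, ← Submodule.mem_comap, Submodule.comap_map_mkQ, sup_comm]
  rw [LinearMap.mem_ker, LinearMap.mem_ker, e1, e2]
  constructor
  · intro h
    exact sup_le le_sup_left h1 h
  · intro h
    obtain ⟨u, hu, v, hv, rfl⟩ := Submodule.mem_sup.1 h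
    refine add_mem (Submodule.mem_sup_left hu) (Submodule.mem_sup_right (h2 v ?_ hv))
    have := sub_mem ha (Ideal.pow_le_pow_right n.le_succ hu)
    rwa [add_sub_cancel_left] at this

lemma length_quot_quot (t b : Ideal R) :
    Module.length R ((R ⧸ b) ⧸ (t • ⊤ : Submodule R (R ⧸ b))) = Module.length R (R ⧸ (t + b)) := by
  have h3 : (t • ⊤ : Submodule R (R ⧸ b)) = Submodule.map (Submodule.mkQ b) t := by
    have : (t : Submodule R R) = t • ⊤ := by simp
    conv_rhs => rw [this]
    rw [Submodule.map_smul'', Submodule.map_top, Submodule.range_mkQ]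
  rw [h3]
  have h4 : t + b = b ⊔ t := sup_comm _ _
  rw [h4]
  exact (Submodule.quotientQuotientEquivQuotientSup b t).length_eq

end filt
end LQ

set_option maxHeartbeats 2000000

/-- Let `(S, 𝔪)` be a regular local ring of Krull dimension `d ≥ 1` (a Noetherian
local ring whose maximal ideal is generated by `d` elements, `d` being its Krull
dimension), let `R` be a commutative `S`-algebra, `𝔱 = 𝔪R`, and let
`b : ℕ → Ideal R` be antitone with `b 0 = R` and `R/b_p` flat over `S` for all `p`.
Then for every `m ≥ 1`,
`length_R(R/∑_{j=0}^m 𝔱^j b_{m-j}) = ∑_{ℓ=0}^{m-1} C(ℓ+d-1, d-1) · length_R(R/(𝔱 + b_{m-ℓ}))`. -/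
theorem length_quotient_sum_eq_sum_choose_mul_length {S : Type*} [CommRing S]
    [IsNoetherianRing S] [IsLocalRing S] (d : ℕ) (hd : 1 ≤ d)
    (hdim : ringKrullDim S = d)
    (hreg : ∃ s : Finset S, s.card = d ∧ Ideal.span (s : Set S) = maximalIdeal S)
    {R : Type*} [CommRing R] [Algebra S R]
    (b : ℕ → Ideal R) (hb : Antitone b) (hb0 : b 0 = ⊤)
    (hflat : ∀ p, Module.Flat S (R ⧸ b p))
    (m : ℕ) (hm : 1 ≤ m) :
    moduleLength R
        (R ⧸ ∑ j ∈ Finset.range (m + 1),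
          (maximalIdeal S).map (algebraMap S R) ^ j * b (m - j)) =
      ∑ ℓ ∈ Finset.range m,
        ((ℓ + d - 1).choose (d - 1) : ℕ∞) *
          moduleLength R
            (R ⧸ ((maximalIdeal S).map (algebraMap S R) + b (m - ℓ))) := by
  classical
  obtain ⟨s, hs, hspan⟩ := hreg
  set l := s.toList with hl
  have hlen : l.length = d := by simp [hl, hs]
  have hlm : Ideal.ofList l = maximalIdeal S := by
    rw [← hspan]; simp [Ideal.ofList, hl]
  have hreg : LQ.PR S l := by
    intro l' hp
    refine LQ.isWeaklyRegular_aux d hdim.ge l' (hp.length_eq.trans hlen) ?_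
    rw [← hlm]
    simp [Ideal.ofList, hp.mem_iff]
  set t := (maximalIdeal S).map (algebraMap S R) with ht
  have htl : Ideal.ofList (l.map (algebraMap S R)) = t := by
    rw [← Ideal.map_ofList, hlm]
  set J := ∑ j ∈ Finset.range (m + 1), t ^ j * b (m - j) with hJ
  have hml : ∀ I : Ideal R, moduleLength R (R ⧸ I) = Module.length R (R ⧸ I) :=
    fun I => (Module.length_eq_height R (R ⧸ I)).symm
  simp only [hml]
  have hmemJ : ∀ j, j ≤ m → t ^ j * b (m - j) ≤ J := by
    intro j hj
    rw [hJ, Ideal.sum_eq_sup]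
    exact Finset.le_sup (f := fun j => t ^ j * b (m - j)) (by simp; omega)
  have hstep : ∀ n, n < m → Module.length R (R ⧸ (t ^ (n+1) ⊔ J)) =
      ((n + d - 1).choose (d - 1) : ℕ∞) * Module.length R (R ⧸ (t + b (m - n))) +
        Module.length R (R ⧸ (t ^ n ⊔ J)) := by
    intro n hn
    have hfl := hflat (m - n)
    rw [LQ.filt_step t J (b (m - n)) n]
    · congr 1
      rw [← htl, LQ.gl_eq _ (LQ.PR_flat l hreg), htl, List.length_map, hlen, Nat.multichoose_eq]
      congr 1
      · norm_cast
        rw [add_comm d n]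
        rw [← Nat.choose_symm (by omega : n ≤ n + d - 1)]
        congr 1
        omega
      · exact LQ.length_quot_quot t (b (m - n))
    · rw [hJ, Ideal.sum_eq_sup]
      refine Finset.sup_le fun j hj => ?_
      by_cases hjn : j ≤ n
      · have hbb : b (m - j) ≤ b (m - n) := hb (by omega)
        exact (Ideal.mul_le_right.trans hbb).trans le_sup_right
      · have htt : t ^ j ≤ t ^ (n + 1) := Ideal.pow_le_pow_right (by omega)
        exact (Ideal.mul_le_left.trans htt).trans le_sup_left
    · intro z hz hzb
      refine hmemJ n hn.le ?_
      rw [ht, ← Ideal.map_pow] at hz ⊢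
      exact LQ.flat_inter _ hfl _ z hz hzb
  have hall : ∀ n, n ≤ m → Module.length R (R ⧸ (t ^ n ⊔ J)) = ∑ ℓ ∈ Finset.range n,
        ((ℓ + d - 1).choose (d - 1) : ℕ∞) * Module.length R (R ⧸ (t + b (m - ℓ))) := by
    intro n
    induction n with
    | zero =>
      intro _
      rw [Finset.sum_range_zero, Module.length_eq_zero_iff]
      apply Ideal.Quotient.subsingleton_iff.2
      simp
    | succ n ih =>
      intro hn
      rw [hstep n hn, ih (by omega), Finset.sum_range_succ, add_comm]
  have hfin : t ^ m ⊔ J = J := by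
    refine sup_eq_right.2 ?_
    have := hmemJ m le_rfl
    rwa [Nat.sub_self, hb0, Ideal.mul_top] at this
  rw [← hall m le_rfl, hfin]
end

section
/- Let n and d be integers with 1 ≤ d < n, let v ≥ 0 be a real number, and let f : ℕ → ℝ be a function satisfying f(p) = (v/(n−d)!)·p^{n−d} + O(p^{n−d−1}) as p → ∞. Then ∑_{ℓ=0}^{m-1} C(ℓ+d−1, d−1)·f(m−ℓ) = (v/n!)·m^n + O(m^{n-1}) as m → ∞, where C(·,·) is the binomial coefficient. -/
open scoped Nat
open Filter Asymptotics

lemma aux_pow (x : ℝ) (hx : 0 ≤ x) (j : ℕ) :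
    ((j : ℝ) + 1) * x ^ j ≤ (x + 1) ^ (j + 1) - x ^ (j + 1) ∧
      (x + 1) ^ (j + 1) - x ^ (j + 1) ≤ ((j : ℝ) + 1) * (x + 1) ^ j := by
  induction j with
  | zero => simp
  | succ j ih =>
    obtain ⟨h1, h2⟩ := ih
    have h3 : x ^ (j + 1) ≤ (x + 1) ^ (j + 1) := pow_le_pow_left₀ hx (by linarith) _
    have h4 := mul_le_mul_of_nonneg_left h1 hx
    have h5 := mul_le_mul_of_nonneg_left h2 (by linarith : 0 ≤ x + 1)
    push_cast
    constructor
    · calc ((j : ℝ) + 1 + 1) * x ^ (j + 1) = x * (((j : ℝ) + 1) * x ^ j) + x ^ (j + 1) := by ring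
        _ ≤ x * ((x + 1) ^ (j + 1) - x ^ (j + 1)) + (x + 1) ^ (j + 1) := by linarith
        _ = _ := by ring
    · calc (x + 1) ^ (j + 1 + 1) - x ^ (j + 1 + 1)
          = (x + 1) * ((x + 1) ^ (j + 1) - x ^ (j + 1)) + x ^ (j + 1) := by ring
        _ ≤ (x + 1) * (((j : ℝ) + 1) * (x + 1) ^ j) + (x + 1) ^ (j + 1) := by linarith
        _ = _ := by ring

lemma aux_step (A g : ℕ → ℝ) (c : ℝ) (k : ℕ) (h0 : A 0 = 0)
    (hA : ∀ m, A (m + 1) = A m + g (m + 1))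
    (hg : ∃ C : ℝ, ∀ p : ℕ, 1 ≤ p → |g p - c * (p : ℝ) ^ (k + 1)| ≤ C * (p : ℝ) ^ k) :
    ∃ C : ℝ, ∀ p : ℕ, 1 ≤ p →
      |A p - c / ((k : ℝ) + 2) * (p : ℝ) ^ (k + 2)| ≤ C * (p : ℝ) ^ (k + 1) := by
  obtain ⟨C, hC⟩ := hg
  have hC0 : 0 ≤ C := by
    have := (abs_nonneg _).trans (hC 1 le_rfl)
    simpa using this
  have hD0 : 0 ≤ C + |c| * ((k : ℝ) + 1) := by positivity
  refine ⟨C + |c| * ((k : ℝ) + 1), fun p _ => ?_⟩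
  induction p with
  | zero => simp [h0]
  | succ m ih =>
    have ih : |A m - c / ((k : ℝ) + 2) * (m : ℝ) ^ (k + 2)| ≤
        (C + |c| * ((k : ℝ) + 1)) * (m : ℝ) ^ (k + 1) := by
      rcases Nat.eq_zero_or_pos m with h | h
      · subst h; simp [h0]
      · exact ih h
    have hg := hC (m + 1) (by omega)
    rw [hA]
    push_cast at hg ⊢
    have hx : (0 : ℝ) ≤ m := Nat.cast_nonneg m
    generalize (m : ℝ) = x at *
    obtain ⟨a1, a2⟩ := aux_pow x hx (k + 1)
    obtain ⟨b1, b2⟩ := aux_pow x hx k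
    push_cast at a1 a2
    have hk : (0 : ℝ) < (k : ℝ) + 2 := by positivity
    have e : |(x + 1) ^ (k + 1) - ((x + 1) ^ (k + 2) - x ^ (k + 2)) / ((k : ℝ) + 2)| ≤
        ((k : ℝ) + 1) * (x + 1) ^ k := by
      have l1 : x ^ (k + 1) ≤ ((x + 1) ^ (k + 2) - x ^ (k + 2)) / ((k : ℝ) + 2) := by
        rw [le_div_iff₀ hk]; linarith
      have l2 : ((x + 1) ^ (k + 2) - x ^ (k + 2)) / ((k : ℝ) + 2) ≤ (x + 1) ^ (k + 1) := by
        rw [div_le_iff₀ hk]; linarith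
      rw [abs_of_nonneg (by linarith)]
      linarith
    have e2 := mul_le_mul_of_nonneg_left e (abs_nonneg c)
    rw [← abs_mul] at e2
    have h3 : x ^ k ≤ (x + 1) ^ k := pow_le_pow_left₀ hx (by linarith) _
    have h4 : x ^ (k + 1) ≤ x * (x + 1) ^ k := by
      rw [pow_succ, mul_comm]; exact mul_le_mul_of_nonneg_left h3 hx
    have h5 := mul_le_mul_of_nonneg_left h4 hD0
    calc _ = |(A m - c / ((k : ℝ) + 2) * x ^ (k + 2)) + (g (m + 1) - c * (x + 1) ^ (k + 1)) +
          c * ((x + 1) ^ (k + 1) - ((x + 1) ^ (k + 2) - x ^ (k + 2)) / ((k : ℝ) + 2))| := by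
          congr 1; ring
      _ ≤ _ := abs_add_three _ _ _
      _ ≤ (C + |c| * ((k : ℝ) + 1)) * (x * (x + 1) ^ k) + C * (x + 1) ^ k +
          |c| * (((k : ℝ) + 1) * (x + 1) ^ k) := by linarith
      _ = _ := by ring

lemma aux_conv (f : ℕ → ℝ) (e m : ℕ) :
    (∑ l ∈ Finset.range (m + 1), ((l + (e + 1)).choose (e + 1) : ℝ) * f (m + 1 - l)) =
      (∑ l ∈ Finset.range m, ((l + (e + 1)).choose (e + 1) : ℝ) * f (m - l)) +
      ∑ l ∈ Finset.range (m + 1), ((l + e).choose e : ℝ) * f (m + 1 - l) := by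
  have h : ∀ l, ((l + (e + 1)).choose (e + 1) : ℝ) * f (m + 1 - l) =
      ((l + e).choose (e + 1) : ℝ) * f (m + 1 - l) + ((l + e).choose e : ℝ) * f (m + 1 - l) := by
    intro l
    rw [← add_assoc, Nat.choose_succ_succ]
    push_cast; ring
  rw [Finset.sum_congr rfl (fun l _ => h l), Finset.sum_add_distrib]
  congr 1
  rw [Finset.sum_range_succ']
  simp only [zero_add, Nat.choose_succ_self, Nat.cast_zero, zero_mul, add_zero]
  refine Finset.sum_congr rfl fun l _ => ?_
  rw [show l + 1 + e = l + (e + 1) by ring, Nat.add_sub_add_right]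

lemma aux_main (f : ℕ → ℝ) (v : ℝ) (k : ℕ)
    (hf : ∃ C : ℝ, ∀ p : ℕ, 1 ≤ p →
      |f p - v / (k + 1)! * (p : ℝ) ^ (k + 1)| ≤ C * (p : ℝ) ^ k) (e : ℕ) :
    ∃ C : ℝ, ∀ p : ℕ, 1 ≤ p →
      |(∑ l ∈ Finset.range p, ((l + e).choose e : ℝ) * f (p - l)) -
        v / (k + e + 2)! * (p : ℝ) ^ (k + e + 2)| ≤ C * (p : ℝ) ^ (k + e + 1) := by
  have fac : ∀ j : ℕ, v / (j + 1)! / ((j : ℝ) + 2) = v / (j + 2)! := by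
    intro j
    rw [Nat.factorial_succ (j + 1), div_div]
    push_cast
    congr 1; ring
  induction e with
  | zero =>
    have := aux_step (fun p => ∑ l ∈ Finset.range p, ((l + 0).choose 0 : ℝ) * f (p - l)) f _ k
      (by simp) (fun m => by
        simp only [add_zero, Nat.choose_zero_right, Nat.cast_one, one_mul]
        rw [Finset.sum_range_succ']
        simp) hf
    rw [fac] at this
    exact this
  | succ e ih =>
    have := aux_step
      (fun p => ∑ l ∈ Finset.range p, ((l + (e + 1)).choose (e + 1) : ℝ) * f (p - l)) _ _ (k + e + 1)
      (by simp) (fun m => aux_conv f e m) ih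
    rw [fac (k + e + 1)] at this
    exact this

/-- Let `1 ≤ d < n`, `v ≥ 0`, and `f : ℕ → ℝ` with
`f(p) = (v/(n-d)!) p^(n-d) + O(p^(n-d-1))` as `p → ∞`. Then
`∑_{ℓ=0}^{m-1} C(ℓ+d-1, d-1) f(m-ℓ) = (v/n!) m^n + O(m^(n-1))` as `m → ∞`. -/
theorem sum_choose_mul_asymptotic (n d : ℕ) (hd : 1 ≤ d) (hdn : d < n)
    (v : ℝ) (hv : 0 ≤ v) (f : ℕ → ℝ)
    (hf : (fun p : ℕ => f p - v / (n - d)! * (p : ℝ) ^ (n - d)) =O[atTop]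
      fun p : ℕ => (p : ℝ) ^ (n - d - 1)) :
    (fun m : ℕ =>
        (∑ ℓ ∈ Finset.range m, ((ℓ + d - 1).choose (d - 1) : ℝ) * f (m - ℓ)) -
          v / n ! * (m : ℝ) ^ n) =O[atTop]
      fun m : ℕ => (m : ℝ) ^ (n - 1) := by
  obtain ⟨C, -, hC⟩ := bound_of_isBigO_nat_atTop hf
  obtain ⟨e, rfl⟩ : ∃ e, d = e + 1 := ⟨d - 1, by omega⟩
  obtain ⟨k, rfl⟩ : ∃ k, n = k + e + 2 := ⟨n - e - 2, by omega⟩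
  have e1 : k + e + 2 - (e + 1) = k + 1 := by omega
  rw [e1] at hC
  have hf' : ∃ C : ℝ, ∀ p : ℕ, 1 ≤ p →
      |f p - v / (k + 1)! * (p : ℝ) ^ (k + 1)| ≤ C * (p : ℝ) ^ k := by
    refine ⟨C, fun p hp => ?_⟩
    have hp' : (0 : ℝ) < p := by exact_mod_cast hp
    have := hC (x := p) (by positivity)
    simpa [Real.norm_eq_abs] using this
  obtain ⟨D, hD⟩ := aux_main f v k hf' e
  refine IsBigO.of_bound D ?_
  filter_upwards [eventually_ge_atTop 1] with m hm
  have := hD m hm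
  rw [Real.norm_eq_abs, Real.norm_eq_abs, abs_of_nonneg (by positivity : (0 : ℝ) ≤ (m : ℝ) ^ (k + e + 2 - 1))]
  exact this
end
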